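/- Fix integers n, m ≥ 1 and consider the constraint matrix A of the bipartite matching LP: A is the (n + m) × (nm + m) real matrix whose columns are indexed by the variables X_{i'j'} (for i' ∈ {1,…,n}, j' ∈ {1,…,m}) and s_{j'} (for j' ∈ {1,…,m}), with A[i, X_{i'j'}] = 1 if i = i' and 0 otherwise for rows i ∈ {1,…,n}; A[n + j, X_{i'j'}] = 1 if j = j' and 0 otherwise for rows j ∈ {1,…,m}; A[i, s_{j'}] = 0 for rows i ∈ {1,…,n}; and A[n + j, s_{j'}] = 1 if j = j' and 0 otherwise. Then A is totally unimodular: every square submatrix of A has determinant equal to −1, 0, or 1. -/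

import Mathlib

open Matrix

/-- A 0/1 matrix whose rows are 2-coloured so that every column has at most one nonzero
entry in each colour has determinant -1, 0 or 1. -/
theorem det_two_coloured (k : ℕ) : ∀ (M : Matrix (Fin k) (Fin k) ℝ) (c : Fin k → Bool),
    (∀ i j, M i j = 0 ∨ M i j = 1) →
    (∀ i i' j, c i = c i' → i ≠ i' → M i j = 0 ∨ M i' j = 0) →
    M.det = -1 ∨ M.det = 0 ∨ M.det = 1 := by
  induction k with
  | zero => intro M c _ _; right; right; simp
  | succ k ih =>
    intro M c h01 hc
    by_cases hfull : ∀ j b, ∃ i, c i = b ∧ M i j ≠ 0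
    · right; left
      apply Matrix.exists_vecMul_eq_zero_iff.mp
      refine ⟨fun i => if c i then 1 else -1, ?_, ?_⟩
      · intro h
        have := congrFun h 0
        simp only [Pi.zero_apply] at this
        split_ifs at this <;> norm_num at this
      · funext j
        obtain ⟨i1, hi1, h1⟩ := hfull j true
        obtain ⟨i2, hi2, h2⟩ := hfull j false
        have hne : i1 ≠ i2 := by rintro rfl; simp [hi1] at hi2
        have e1 := (h01 i1 j).resolve_left h1
        have e2 := (h01 i2 j).resolve_left h2
        simp only [Matrix.vecMul, dotProduct, Pi.zero_apply]
        rw [Finset.sum_eq_add i1 i2 hne]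
        · simp [hi1, hi2, e1, e2]
        · rintro i - ⟨n1, n2⟩
          have : M i j = 0 := by
            cases hci : c i
            · exact (hc i i2 j (by rw [hci, hi2]) n2).resolve_right h2
            · exact (hc i i1 j (by rw [hci, hi1]) n1).resolve_right h1
          simp [this]
        · simp
        · simp
    · push Not at hfull
      obtain ⟨j, b, hb⟩ := hfull
      by_cases hz : ∀ i, M i j = 0
      · right; left
        exact Matrix.det_eq_zero_of_column_eq_zero j hz
      · push Not at hz
        obtain ⟨i0, hi0⟩ := hz
        have e0 := (h01 i0 j).resolve_left hi0
        have hother : ∀ i, i ≠ i0 → M i j = 0 := by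
          intro i hi
          by_contra hne
          have a1 : c i ≠ b := fun h => hne (hb i h)
          have a2 : c i0 ≠ b := fun h => hi0 (hb i0 h)
          have : c i = c i0 := by
            revert a1 a2
            cases c i <;> cases c i0 <;> cases b <;> simp
          rcases hc i i0 j this hi with h | h
          · exact hne h
          · exact hi0 h
        rw [Matrix.det_succ_column M j, Finset.sum_eq_single i0]
        · have := ih (M.submatrix i0.succAbove j.succAbove) (fun i => c (i0.succAbove i))
            (fun i j => h01 _ _)
            (fun i i' j h hne => hc _ _ _ h (fun h => hne (Fin.succAbove_right_injective h)))
          rcases neg_one_pow_eq_or ℝ ((i0 : ℕ) + (j : ℕ)) with hs | hs <;>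
            rcases this with h | h | h <;> rw [hs, h, e0] <;> norm_num
        · intro i _ hi
          simp [hother i hi]
        · simp

/-- the constraint matrix of the bipartite matching LP is totally
unimodular: every square submatrix has determinant −1, 0, or 1. -/
theorem bipartite_matching_constraint_matrix_TU
    (n m : ℕ) (hn : 1 ≤ n) (hm : 1 ≤ m)
    (A : Matrix (Fin n ⊕ Fin m) ((Fin n × Fin m) ⊕ Fin m) ℝ)
    (hA : ∀ r cc, A r cc =
      match r, cc with
      | Sum.inl i, Sum.inl (i', _) => if i = i' then (1 : ℝ) else 0
      | Sum.inr j, Sum.inl (_, j') => if j = j' then (1 : ℝ) else 0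
      | Sum.inl _, Sum.inr _ => (0 : ℝ)
      | Sum.inr j, Sum.inr j' => if j = j' then (1 : ℝ) else 0) :
    ∀ (k : ℕ) (f : Fin k → Fin n ⊕ Fin m) (g : Fin k → (Fin n × Fin m) ⊕ Fin m),
      Function.Injective f → Function.Injective g →
      (A.submatrix f g).det = -1 ∨ (A.submatrix f g).det = 0 ∨
        (A.submatrix f g).det = 1 := by
  intro k f g hf _
  refine det_two_coloured k _ (fun i => (f i).isLeft) ?_ ?_
  · intro i j
    rw [Matrix.submatrix_apply, hA]
    rcases f i with a | a <;> rcases g j with ⟨x, y⟩ | y <;> simp only <;>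
      first
      | (split_ifs <;> simp)
      | simp
  · intro i i' j hcol hne
    have hff : f i ≠ f i' := fun h => hne (hf h)
    rw [Matrix.submatrix_apply, Matrix.submatrix_apply, hA, hA]
    revert hcol hff
    rcases f i with a | a <;> rcases f i' with a' | a' <;>
      rcases g j with ⟨x, y⟩ | y <;> simp <;> grind
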